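/- For any c with 0 < c < 1/2, if the quantization bandwidth b satisfies b ≥ log₂(√(4d/c) + 1), then the max-min dynamic quantizer satisfies the relative error bound ‖x − Q(x)‖₂² ≤ c‖x‖₂². -/

import Mathlib

/-- Rounding both `y` and the offset `m` down, then clamping to `[0, N]`, moves `y` by at most one
whenever `y + m` lies in `[0, N]`. -/
theorem abs_sub_clamp_floor_le_one {y m : ℝ} {N : ℤ} (h0 : 0 ≤ y + m) (hN : y + m ≤ N) :
    |y - ((max 0 (min N (⌊y⌋ + ⌊m⌋)) : ℤ) - (⌊m⌋ : ℝ))| ≤ 1 := by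
  have hy := Int.floor_le y
  have hy' := Int.lt_floor_add_one y
  have hm := Int.floor_le m
  have hm' := Int.lt_floor_add_one m
  have hle : ⌊y⌋ + ⌊m⌋ ≤ N := by
    have : ((⌊y⌋ + ⌊m⌋ : ℤ) : ℝ) ≤ N := by push_cast; linarith
    exact_mod_cast this
  have hge : -2 < ⌊y⌋ + ⌊m⌋ := by
    have : ((-2 : ℤ) : ℝ) < ((⌊y⌋ + ⌊m⌋ : ℤ) : ℝ) := by push_cast; linarith
    exact_mod_cast this
  rw [min_eq_right hle, abs_le]
  rcases le_or_gt 0 (⌊y⌋ + ⌊m⌋) with h | h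
  · rw [max_eq_right h]
    push_cast
    constructor <;> linarith
  · have h1 : ((⌊y⌋ + ⌊m⌋ : ℤ) : ℝ) = ((-1 : ℤ) : ℝ) := by
      congr 1
      omega
    rw [max_eq_left h.le]
    push_cast at h1 ⊢
    constructor <;> linarith

/-- Corollary: for any `0 < c < 1/2`, if the bandwidth satisfies
`b ≥ log₂(√(4d/c) + 1)`, then `‖x − Q(x)‖₂² ≤ c‖x‖₂²` for the max-min dynamic
quantizer. -/
theorem maxmin_quantizer_relative_error_bound_of_bandwidth
    {d : ℕ} (hd : 1 ≤ d) (b : ℕ) (hb : 1 ≤ b)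
    (x : EuclideanSpace ℝ (Fin d)) (xmax xmin : ℝ)
    (hmax : IsGreatest (Set.range x) xmax)
    (hmin : IsLeast (Set.range x) xmin)
    (hlt : xmin < xmax)
    (s : ℝ) (hs : s = (xmax - xmin) / ((2 : ℝ) ^ b - 1))
    (z : ℤ) (hz : z = ⌊-xmin / s⌋)
    (xint : Fin d → ℤ)
    (hxint : ∀ i, xint i = max 0 (min ((2 : ℤ) ^ b - 1) (⌊x i / s⌋ + z)))
    (Qx : EuclideanSpace ℝ (Fin d))
    (hQ : ∀ i, Qx i = s * ((xint i : ℝ) - (z : ℝ)))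
    (c : ℝ) (hc0 : 0 < c) (hc1 : c < 1 / 2)
    (hbc : Real.logb 2 (Real.sqrt (4 * d / c) + 1) ≤ (b : ℝ)) :
    ‖x - Qx‖ ^ 2 ≤ c * ‖x‖ ^ 2 := by
  have hsqrt : √(4 * d / c) ≤ 2 ^ b - 1 := by
    rw [Real.logb_le_iff_le_rpow one_lt_two (by positivity), Real.rpow_natCast] at hbc
    linarith
  have hd0 : (0 : ℝ) < d := by exact_mod_cast hd
  have hN : (0 : ℝ) < 2 ^ b - 1 := (Real.sqrt_pos.2 (by positivity)).trans_le hsqrt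
  have hNsq : 4 * d / c ≤ ((2 : ℝ) ^ b - 1) ^ 2 := (Real.sqrt_le_left hN.le).1 hsqrt
  have hs0 : 0 < s := hs ▸ div_pos (sub_pos.2 hlt) hN
  have hsN : s * (2 ^ b - 1) = xmax - xmin := by rw [hs, div_mul_cancel₀ _ hN.ne']
  have herr (i : Fin d) : ‖(x - Qx) i‖ ^ 2 ≤ s ^ 2 := by
    have hlo : xmin ≤ x i := hmin.2 ⟨i, rfl⟩
    have hhi : x i ≤ xmax := hmax.2 ⟨i, rfl⟩
    have hsum : x i / s + -xmin / s = (x i - xmin) / s := by ring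
    have h := abs_sub_clamp_floor_le_one (y := x i / s) (m := -xmin / s) (N := 2 ^ b - 1)
      (by rw [hsum]; exact div_nonneg (by linarith) hs0.le)
      (by rw [hsum, div_le_iff₀ hs0]; push_cast; linarith)
    rw [← hz, ← hxint i] at h
    have hfac : (x - Qx) i = s * (x i / s - ((xint i : ℝ) - z)) := by
      rw [PiLp.sub_apply, hQ, mul_sub s (x i / s), mul_div_cancel₀ _ hs0.ne']
    rw [hfac, Real.norm_eq_abs, abs_mul, abs_of_pos hs0]
    gcongr
    exact mul_le_of_le_one_right hs0.le h
  have hrange : xmax - xmin ≤ 2 * ‖x‖ := by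
    obtain ⟨i, rfl⟩ := hmax.1
    obtain ⟨j, rfl⟩ := hmin.1
    have hi := (abs_le.1 (PiLp.norm_apply_le x i)).2
    have hj := (abs_le.1 (PiLp.norm_apply_le x j)).1
    linarith
  have hds : d * s ^ 2 ≤ c / 4 * (xmax - xmin) ^ 2 := by
    rw [div_le_iff₀ hc0] at hNsq
    rw [← hsN]
    nlinarith [mul_le_mul_of_nonneg_left hNsq (sq_nonneg s)]
  calc ‖x - Qx‖ ^ 2 = ∑ i, ‖(x - Qx) i‖ ^ 2 := EuclideanSpace.norm_sq_eq _
    _ ≤ ∑ _i : Fin d, s ^ 2 := Finset.sum_le_sum fun i _ => herr i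
    _ = d * s ^ 2 := by simp
    _ ≤ c / 4 * (xmax - xmin) ^ 2 := hds
    _ ≤ c / 4 * (2 * ‖x‖) ^ 2 := by
      have := sub_pos.2 hlt
      gcongr
    _ = c * ‖x‖ ^ 2 := by ring
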